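/- For every t ∈ [0,1), the generalized Cesàro operator C_t maps H^∞ into the disc algebra: C_t(H^∞) ⊆ A(𝔻), i.e., for every bounded holomorphic function f on the unit disc, C_t f extends continuously to the closed unit disc. -/

import Mathlib

open Complex MeasureTheory Metric Set Filter Topology

/-- The generalized Cesàro operator `C_t`, given by
`(C_t f)(z) = ∫_0^1 f(sz)/(1 - s t z) ds`, which equals `f(0)` at `z = 0` and
`(1/z)∫_0^z f(ξ)/(1 - tξ) dξ` for `z ≠ 0`. -/
noncomputable def cesaro (t : ℝ) (f : ℂ → ℂ) (z : ℂ) : ℂ :=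
  ∫ s in (0:ℝ)..1, f ((s : ℂ) * z) / (1 - (s : ℂ) * (t : ℂ) * z)

/-- Membership in `H^∞`: holomorphic and bounded on the open unit disc. -/
def MemHinf (f : ℂ → ℂ) : Prop :=
  DifferentiableOn ℂ f (Metric.ball (0:ℂ) 1) ∧
    BddAbove ((fun z => ‖f z‖) '' Metric.ball (0:ℂ) 1)

/-- Membership in the disc algebra `A(𝔻)`: holomorphic on the open unit disc and
continuous on the closed unit disc (i.e. extends continuously to the closed disc). -/
def MemDiscAlg (f : ℂ → ℂ) : Prop :=
  DifferentiableOn ℂ f (Metric.ball (0:ℂ) 1) ∧ ContinuousOn f (Metric.closedBall (0:ℂ) 1)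

/-- The Cesàro denominator `1 - w t z` is bounded below by `1 - t` for `w`, `z` in the
closed unit disc. -/
lemma one_sub_le_norm_one_sub_mul {t : ℝ} (ht0 : 0 ≤ t) {w z : ℂ} (hw : ‖w‖ ≤ 1)
    (hz : ‖z‖ ≤ 1) : 1 - t ≤ ‖1 - w * (t : ℂ) * z‖ := by
  have h1 : ‖w * (t : ℂ) * z‖ ≤ t := by
    rw [norm_mul, norm_mul, Complex.norm_real, Real.norm_of_nonneg ht0]
    calc ‖w‖ * t * ‖z‖ ≤ 1 * t * 1 := by gcongr
      _ = t := by ring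
  have h2 := norm_sub_norm_le (1 : ℂ) (w * (t : ℂ) * z)
  rw [norm_one] at h2
  linarith

lemma one_sub_mul_ne_zero {t : ℝ} (ht0 : 0 ≤ t) (ht1 : t < 1) {w z : ℂ} (hw : ‖w‖ ≤ 1)
    (hz : ‖z‖ ≤ 1) : 1 - w * (t : ℂ) * z ≠ 0 := by
  have := one_sub_le_norm_one_sub_mul ht0 hw hz
  exact norm_pos_iff.mp (by linarith)

lemma ofReal_mul_mem_ball {s : ℝ} (hs0 : 0 ≤ s) (hs1 : s < 1) {z : ℂ} (hz : ‖z‖ ≤ 1) :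
    (s : ℂ) * z ∈ ball (0 : ℂ) 1 := by
  rw [mem_ball_zero_iff, norm_mul, Complex.norm_real, Real.norm_of_nonneg hs0]
  nlinarith [norm_nonneg z]

/-- `C_t` preserves holomorphy on the unit disc. -/
lemma differentiableOn_cesaro {t : ℝ} (ht0 : 0 ≤ t) (ht1 : t < 1) {f : ℂ → ℂ}
    (hf : DifferentiableOn ℂ f (ball (0 : ℂ) 1)) :
    DifferentiableOn ℂ (cesaro t f) (ball (0 : ℂ) 1) := by
  have hden : ∀ z ∈ ball (0 : ℂ) 1, 1 - (t : ℂ) * z ≠ 0 := fun z hz => by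
    simpa using one_sub_mul_ne_zero ht0 ht1 (w := 1) (by simp) (mem_ball_zero_iff.mp hz).le
  have hg : DifferentiableOn ℂ (fun z => f z / (1 - (t : ℂ) * z)) (ball (0 : ℂ) 1) :=
    hf.div (by fun_prop) hden
  obtain ⟨G, hG⟩ := hg.isExactOn_ball
  have hGd : DifferentiableOn ℂ G (ball (0 : ℂ) 1) := fun z hz =>
    (hG z hz).differentiableAt.differentiableWithinAt
  have h0 : (0 : ℂ) ∈ ball (0 : ℂ) 1 := by simp
  refine ((Complex.differentiableOn_dslope (ball_mem_nhds 0 one_pos)).mpr hGd).congr ?_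
  intro z hz
  rcases eq_or_ne z 0 with rfl | hz0
  · rw [dslope_same, (hG 0 h0).deriv]
    simp [cesaro]
  have hmem : ∀ s ∈ uIcc (0 : ℝ) 1, (s : ℂ) * z ∈ ball (0 : ℂ) 1 := fun s hs => by
    rw [uIcc_of_le zero_le_one] at hs
    rw [mem_ball_zero_iff] at hz ⊢
    rw [norm_mul, Complex.norm_real, Real.norm_of_nonneg hs.1]
    nlinarith [norm_nonneg z, hs.2]
  have hderiv : ∀ s ∈ uIcc (0 : ℝ) 1, HasDerivAt (fun s : ℝ => G ((s : ℂ) * z))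
      (f ((s : ℂ) * z) / (1 - (t : ℂ) * ((s : ℂ) * z)) * z) s := fun s hs => by
    have h1 : HasDerivAt (fun s : ℝ => (s : ℂ) * z) z s := by
      simpa using (Complex.ofRealCLM.hasDerivAt (x := s)).mul_const z
    exact (hG _ (hmem s hs)).comp s h1
  have hcont : ContinuousOn
      (fun s : ℝ => f ((s : ℂ) * z) / (1 - (t : ℂ) * ((s : ℂ) * z)) * z) (uIcc 0 1) :=
    (hg.continuousOn.comp (f := fun s : ℝ => (s : ℂ) * z) (by fun_prop) hmem).mul
      continuousOn_const
  have hint := intervalIntegral.integral_eq_sub_of_hasDerivAt hderiv hcont.intervalIntegrable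
  rw [intervalIntegral.integral_mul_const] at hint
  rw [dslope_of_ne _ hz0, slope_def_field, eq_div_iff (sub_ne_zero.mpr hz0)]
  simp only [ofReal_one, ofReal_zero, one_mul, zero_mul] at hint
  rw [sub_zero, ← hint, cesaro]
  congr 2
  ext s
  congr 2
  ring

/-- If `f` is continuous and bounded on the open unit disc, then `C_t f` is continuous on the
closed unit disc. -/
lemma continuousOn_cesaro {t : ℝ} (ht0 : 0 ≤ t) (ht1 : t < 1) {f : ℂ → ℂ}
    (hf : ContinuousOn f (ball (0 : ℂ) 1)) {M : ℝ} (hM : ∀ z ∈ ball (0 : ℂ) 1, ‖f z‖ ≤ M) :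
    ContinuousOn (cesaro t f) (closedBall (0 : ℂ) 1) := by
  have hM0 : 0 ≤ M := (norm_nonneg _).trans (hM 0 (by simp))
  have hs : ∀ s ∈ Ioo (0 : ℝ) 1, ‖(s : ℂ)‖ ≤ 1 := fun s hs => by
    rw [Complex.norm_real, Real.norm_of_nonneg hs.1.le]
    exact hs.2.le
  have hae : ∀ᵐ s : ℝ, s ∈ uIoc (0 : ℝ) 1 → s ∈ Ioo (0 : ℝ) 1 := by
    filter_upwards [Measure.ae_ne volume (1 : ℝ)] with s hs1 hs
    rw [uIoc_of_le zero_le_one] at hs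
    exact ⟨hs.1, lt_of_le_of_ne hs.2 hs1⟩
  intro z₀ hz₀
  refine intervalIntegral.continuousWithinAt_of_dominated_interval
    (bound := fun _ => M / (1 - t)) ?_ ?_ intervalIntegrable_const ?_
  · filter_upwards [self_mem_nhdsWithin] with z hz
    rw [mem_closedBall_zero_iff] at hz
    rw [uIoc_of_le zero_le_one, ← restrict_Ioo_eq_restrict_Ioc]
    refine ContinuousOn.aestronglyMeasurable ?_ measurableSet_Ioo
    exact (hf.comp (f := fun s : ℝ => (s : ℂ) * z) (by fun_prop)
      fun s hs => ofReal_mul_mem_ball hs.1.le hs.2 hz).div (by fun_prop)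
      fun s h => one_sub_mul_ne_zero ht0 ht1 (hs s h) hz
  · filter_upwards [self_mem_nhdsWithin] with z hz
    rw [mem_closedBall_zero_iff] at hz
    filter_upwards [hae] with s h h'
    have h := h h'
    rw [norm_div]
    exact div_le_div₀ hM0 (hM _ (ofReal_mul_mem_ball h.1.le h.2 hz)) (by linarith)
      (one_sub_le_norm_one_sub_mul ht0 (hs s h) hz)
  · rw [mem_closedBall_zero_iff] at hz₀
    filter_upwards [hae] with s h h'
    have h := h h'
    have hfs : ContinuousAt f ((s : ℂ) * z₀) :=
      hf.continuousAt (isOpen_ball.mem_nhds (ofReal_mul_mem_ball h.1.le h.2 hz₀))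
    exact ((hfs.comp (f := fun z : ℂ => (s : ℂ) * z) (by fun_prop)).div (by fun_prop)
      (one_sub_mul_ne_zero ht0 ht1 (hs s h) hz₀)).continuousWithinAt

/-- For each `t ∈ [0,1)`, the generalized Cesàro operator maps `H^∞` into the disc
algebra: for every bounded holomorphic `f` on the unit disc, `C_t f` is holomorphic on
the disc and extends continuously to the closed unit disc. -/
theorem cesaro_maps_Hinf_into_discAlg (t : ℝ) (ht0 : 0 ≤ t) (ht1 : t < 1) :
    ∀ f, MemHinf f → MemDiscAlg (cesaro t f) := by
  rintro f ⟨hf, M, hM⟩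
  exact ⟨differentiableOn_cesaro ht0 ht1 hf,
    continuousOn_cesaro ht0 ht1 hf.continuousOn fun z hz => hM (mem_image_of_mem _ hz)⟩
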